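/- Let A be a unital associative ℚ(q)-algebra and let x, y, z ∈ A satisfy xy = qyx, xz = qzx and yz = zy. Then for all n ∈ ℕ and t ∈ ℤ: C_q(x + (q − q^{−1})² yz; t, n) = Σ_{r=0}^{n} q^{r(t−n)} (q − q^{−1})^r [r]_q! · y^{(r)} · {x; t − r | n, r} · z^{(r)}. -/

import Mathlib

open Finset

noncomputable section

/-- The base field `ℚ(q)` of rational functions over `ℚ`. -/
abbrev K : Type := RatFunc ℚ

/-- The indeterminate `q`. -/
def q : K := RatFunc.X

/-- The `x`-number `(n)_x = (x^n - 1)/(x - 1)`. -/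
def qn (x : K) (n : ℕ) : K := (x ^ n - 1) / (x - 1)

/-- The `x`-factorial `(n)_x!`. -/
def qnFact (x : K) (n : ℕ) : K := ∏ r ∈ Finset.Icc 1 n, qn x r

/-- The `x`-binomial coefficient `binom_x(n,s)`, zero when `s > n`. -/
def qBinom (x : K) (n s : ℕ) : K :=
  if s ≤ n then qnFact x n / (qnFact x s * qnFact x (n - s)) else 0

/-- The balanced `q`-integer `[n]_q = (q^n - q^{-n})/(q - q^{-1})`. -/
def qint (n : ℕ) : K := (q ^ n - q⁻¹ ^ n) / (q - q⁻¹)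

/-- The balanced `q`-factorial `[n]_q!`. -/
def qintFact (n : ℕ) : K := ∏ r ∈ Finset.Icc 1 n, qint r

variable {A : Type*} [Ring A] [Algebra K A]

/-- The `q`-divided power `X^{(n)} = X^n / [n]_q!`. -/
def dp (X : A) (n : ℕ) : A := (qintFact n)⁻¹ • X ^ n

/-- The `q`-binomial coefficient `C_q(X; c, n) = ∏_{s=1}^n (q^{c+1-s} X - 1)/(q^s - 1)`. -/
def Cq (X : A) (c : ℤ) : ℕ → A
  | 0 => 1
  | n + 1 => (q ^ ((n : ℤ) + 1) - 1)⁻¹ • (Cq X c n * (q ^ (c - (n : ℤ)) • X - 1))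

/-- The bracket `{X; c | n, r} = Σ_{s=0}^r q^{s(s+1)/2} binom_q(r,s) C_q(X; c+s, n-r)`. -/
def Sq (X : A) (c : ℤ) (n r : ℕ) : A :=
  ∑ s ∈ Finset.range (r + 1),
    (q ^ (s * (s + 1) / 2) * qBinom q r s) • Cq X (c + (s : ℤ)) (n - r)

end

theorem q_ne_zero : q ≠ 0 := RatFunc.X_ne_zero

theorem q_pow_ne_one {n : ℕ} (hn : n ≠ 0) : q ^ n ≠ 1 := by
  intro h
  have h' : algebraMap (Polynomial ℚ) K (Polynomial.X ^ n) = algebraMap (Polynomial ℚ) K 1 := by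
    simpa [q] using h
  have h'' := RatFunc.algebraMap_injective ℚ h'
  have := congrArg Polynomial.natDegree h''
  simp [hn] at this

theorem q_pow_sub_one_ne_zero {n : ℕ} (hn : n ≠ 0) : q ^ n - 1 ≠ 0 :=
  sub_ne_zero.2 (q_pow_ne_one hn)

theorem q_sub_one_ne_zero : q - 1 ≠ 0 := by
  simpa using q_pow_sub_one_ne_zero one_ne_zero

theorem qn_ne_zero {n : ℕ} (hn : n ≠ 0) : qn q n ≠ 0 :=
  div_ne_zero (q_pow_sub_one_ne_zero hn) q_sub_one_ne_zero

theorem q_sub_inv_ne_zero : q - q⁻¹ ≠ 0 := by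
  have h : q - q⁻¹ = (q ^ 2 - 1) / q := by
    field_simp [q_ne_zero]
  rw [h]
  exact div_ne_zero (q_pow_sub_one_ne_zero two_ne_zero) q_ne_zero

theorem qint_mul (n : ℕ) : (q - q⁻¹) * qint n * q ^ n = q ^ (2 * n) - 1 := by
  rw [qint, mul_div_cancel₀ _ q_sub_inv_ne_zero, sub_mul, ← mul_pow,
    ← mul_pow q⁻¹, inv_mul_cancel₀ q_ne_zero]
  ring

theorem qint_ne_zero {n : ℕ} (hn : n ≠ 0) : qint n ≠ 0 := by
  intro h
  have h' := qint_mul n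
  rw [h, mul_zero, zero_mul] at h'
  exact q_pow_sub_one_ne_zero (n := 2 * n) (by omega) h'.symm

theorem qnFact_zero : qnFact q 0 = 1 := by simp [qnFact]

theorem qnFact_succ (n : ℕ) : qnFact q (n + 1) = qnFact q n * qn q (n + 1) := by
  rw [qnFact, Finset.prod_Icc_succ_top (by omega), qnFact]

theorem qintFact_zero : qintFact 0 = 1 := by simp [qintFact]

theorem qintFact_succ (n : ℕ) : qintFact (n + 1) = qintFact n * qint (n + 1) := by
  rw [qintFact, Finset.prod_Icc_succ_top (by omega), qintFact]

theorem qnFact_ne_zero (n : ℕ) : qnFact q n ≠ 0 :=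
  Finset.prod_ne_zero_iff.2 fun _ hr => qn_ne_zero (by simp at hr; omega)

theorem qintFact_ne_zero (n : ℕ) : qintFact n ≠ 0 :=
  Finset.prod_ne_zero_iff.2 fun _ hr => qint_ne_zero (by simp at hr; omega)

theorem qBinom_zero_right (n : ℕ) : qBinom q n 0 = 1 := by
  simp [qBinom, qnFact_zero, qnFact_ne_zero]

theorem qBinom_self (n : ℕ) : qBinom q n n = 1 := by
  simp [qBinom, qnFact_zero, qnFact_ne_zero]

theorem qBinom_of_lt {n s : ℕ} (h : n < s) : qBinom q n s = 0 := by
  simp [qBinom, h]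

theorem qn_add (a b : ℕ) : qn q (a + b) = qn q b + q ^ b * qn q a := by
  have := q_sub_one_ne_zero
  simp only [qn]
  field_simp
  ring

theorem qBinom_succ_succ {r s : ℕ} (h : s ≤ r) :
    qBinom q (r + 1) (s + 1) = qBinom q r (s + 1) + q ^ (r - s) * qBinom q r s := by
  obtain ⟨k, rfl⟩ := Nat.exists_eq_add_of_le h
  rcases k with _ | k
  · simp [qBinom_self, qBinom_of_lt]
  · have e1 : s + (k + 1) + 1 - (s + 1) = k + 1 := by omega
    have e2 : s + (k + 1) - (s + 1) = k := by omega
    have e3 : s + (k + 1) - s = k + 1 := by omega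
    have e4 : s + (k + 1) + 1 = (s + 1) + (k + 1) := by omega
    have hs := qnFact_ne_zero s
    have hk := qnFact_ne_zero k
    have hs' : qn q (s + 1) ≠ 0 := qn_ne_zero (by omega)
    have hk' : qn q (k + 1) ≠ 0 := qn_ne_zero (by omega)
    rw [qBinom, qBinom, qBinom, if_pos (by omega), if_pos (by omega), if_pos (by omega),
      e1, e2, e3, qnFact_succ (s + (k + 1)), e4, qn_add, qnFact_succ s, qnFact_succ k]
    field_simp

section LinearCombinations

variable {F M : Type*} [Field F] [AddCommGroup M] [Module F M]

theorem bracket_recursion_step {s v : F} {m r : ℕ} {P P' Q Q' U U' Y Y' : M}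
    (h : (s ^ (m + r + 1) - 1) • P = s ^ r • (v • Y - Q) + (s ^ (2 * r) - 1) • U)
    (h' : (s ^ (m + r + 1) - 1) • P' = s ^ r • ((s * v) • Y' - Q') + (s ^ (2 * r) - 1) • U')
    (hs : P' = s ^ (m + 1) • P + Q)
    (hP : (s ^ (2 * r) - 1) • P = (s ^ (2 * r) - 1) • (U + s ^ r • U')) :
    (s ^ (m + 1 + r + 1) - 1) • (P + s ^ (r + 1) • P')
      = s ^ (r + 1) • ((s * v) • Y - Q + s ^ (r + 1) • ((s * v) • Y' - Q'))
        + (s ^ (2 * (r + 1)) - 1) • P := by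
  linear_combination (norm := module) (s ^ 2) • h + (s ^ (r + 2)) • h'
    + (s ^ (r + 1) * (s - 1)) • hs - (s ^ 2) • hP

theorem expansion_step {a b d e l N : F} {S U V W Y : M}
    (h : (N - 1) • S = e • ((a * b) • Y - W) + (b - 1) • U) :
    (e * d) • (a • b • Y + a • l • V - W)
      = (N - 1) • d • S + ((a * l * (e * d)) • V - (d * b - d) • U) := by
  linear_combination (norm := module) (-d) • h

end LinearCombinations

section Brackets

variable {R : Type*} [Ring R] [Algebra K R]

theorem Cq_zpow_smul (X : R) (k c : ℤ) (n : ℕ) : Cq (q ^ k • X) c n = Cq X (c + k) n := by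
  induction n with
  | zero => rfl
  | succ n ih =>
    have e : c - n + k = c + k - n := by ring
    rw [Cq, Cq, ih, smul_smul, ← zpow_add₀ q_ne_zero, e]

theorem Sq_zpow_smul (X : R) (k c : ℤ) (n r : ℕ) : Sq (q ^ k • X) c n r = Sq X (c + k) n r := by
  simp only [Sq, Cq_zpow_smul]
  refine Finset.sum_congr rfl fun s _ => ?_
  rw [add_right_comm]

theorem Cq_semiconj {b X Y : R} (h : SemiconjBy b X Y) (c : ℤ) (n : ℕ) :
    SemiconjBy b (Cq X c n) (Cq Y c n) := by
  induction n with
  | zero => exact SemiconjBy.one_right b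
  | succ n ih =>
    have hf : SemiconjBy b (q ^ (c - (n : ℤ)) • X - 1) (q ^ (c - (n : ℤ)) • Y - 1) :=
      SemiconjBy.sub_right (by simp only [SemiconjBy, mul_smul_comm, smul_mul_assoc, h.eq])
        (SemiconjBy.one_right b)
    have hm := ih.mul_right hf
    simp only [SemiconjBy, Cq, mul_smul_comm, smul_mul_assoc] at hm ⊢
    rw [hm]

theorem Sq_semiconj {b X Y : R} (h : SemiconjBy b X Y) (c : ℤ) (n r : ℕ) :
    SemiconjBy b (Sq X c n r) (Sq Y c n r) := by
  simp only [SemiconjBy, Sq, Finset.mul_sum, Finset.sum_mul, mul_smul_comm, smul_mul_assoc,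
    (Cq_semiconj h _ _).eq]

theorem Cq_succ (X : R) (c : ℤ) (n : ℕ) :
    (q ^ (n + 1) - 1) • Cq X c (n + 1) = (q ^ (c - (n : ℤ)) • X - 1) * Cq X c n := by
  have hc : Commute X (Cq X c n) := Cq_semiconj (Commute.refl X) c n
  rw [Cq, smul_smul, ← Nat.cast_succ, zpow_natCast,
    mul_inv_cancel₀ (q_pow_sub_one_ne_zero n.succ_ne_zero), one_smul]
  exact (((hc.smul_left _).sub_left (Commute.one_left _)).eq).symm

theorem Cq_succ_shift (X : R) (c : ℤ) (n : ℕ) :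
    Cq X (c + 1) (n + 1) = q ^ (n + 1) • Cq X c (n + 1) + Cq X c n := by
  have h : ∀ n : ℕ, (q ^ (n + 1) - 1) • Cq X (c + 1) (n + 1)
      = (q ^ (c + 1) • X - 1) * Cq X c n := by
    intro n
    induction n with
    | zero => rw [Cq_succ]; simp [Cq]
    | succ n ih =>
      have hc : Commute X (Cq X (c + 1) (n + 1)) := Cq_semiconj (Commute.refl X) _ _
      have hcc : Commute (q ^ (c - (n : ℤ)) • X - 1) (q ^ (c + 1) • X - 1) :=
        ((((Commute.refl X).smul_left _).smul_right _).sub_left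
          (Commute.one_left _)).sub_right (Commute.one_right _)
      apply smul_right_injective R (q_pow_sub_one_ne_zero n.succ_ne_zero)
      have e : c + 1 - ((n + 1 : ℕ) : ℤ) = c - n := by push_cast; ring
      simp only [Nat.succ_eq_add_one]
      rw [Cq_succ, e, ← mul_smul_comm, ih, ← mul_assoc, hcc.eq, mul_assoc, ← Cq_succ,
        mul_smul_comm]
  apply smul_right_injective R (q_pow_sub_one_ne_zero n.succ_ne_zero)
  simp only [Nat.succ_eq_add_one]
  have e : c + 1 = (n + 1 : ℕ) + (c - n) := by push_cast; ring
  have hz : q ^ (c + 1) = q ^ (n + 1) * q ^ (c - (n : ℤ)) := by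
    rw [← zpow_natCast, ← zpow_add₀ q_ne_zero, ← e]
  rw [h, smul_add, smul_comm, Cq_succ, hz, sub_mul, sub_mul, smul_mul_assoc, smul_mul_assoc,
    one_mul, smul_sub, smul_smul, sub_smul, one_smul]
  abel

theorem Sq_zero_right (X : R) (c : ℤ) (n : ℕ) : Sq X c n 0 = Cq X c n := by
  simp [Sq, qBinom_zero_right]

theorem Sq_succ_right (X : R) (c : ℤ) (m r : ℕ) :
    Sq X c (m + (r + 1)) (r + 1)
      = Sq X c (m + r) r + q ^ (r + 1) • Sq X (c + 1) (m + r) r := by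
  simp only [Sq, Nat.add_sub_cancel]
  have h0 : ∑ s ∈ range (r + 1), (q ^ (s * (s + 1) / 2) * qBinom q r s) • Cq X (c + (s : ℤ)) m
      = ∑ s ∈ range (r + 1 + 1),
          (q ^ (s * (s + 1) / 2) * qBinom q r s) • Cq X (c + (s : ℤ)) m := by
    rw [Finset.sum_range_succ _ (r + 1), qBinom_of_lt (Nat.lt_succ_self r)]
    simp
  rw [h0, Finset.sum_range_succ', Finset.sum_range_succ' _ (r + 1), qBinom_zero_right,
    qBinom_zero_right, add_right_comm, Finset.smul_sum, ← Finset.sum_add_distrib]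
  congr 1
  refine Finset.sum_congr rfl fun s hs => ?_
  have hsr : s ≤ r := by simp at hs; omega
  have e : (s + 1) * (s + 1 + 1) / 2 = s * (s + 1) / 2 + (s + 1) := by
    rw [show (s + 1) * (s + 1 + 1) = s * (s + 1) + (s + 1) * 2 by ring,
      Nat.add_mul_div_right _ _ two_pos]
  have ec : c + ((s + 1 : ℕ) : ℤ) = c + 1 + s := by push_cast; ring
  have ep : q ^ (s + 1) * q ^ (r - s) = q ^ (r + 1) := by
    rw [← pow_add]; congr 1; omega
  rw [qBinom_succ_succ hsr, e, ec, smul_smul, ← add_smul, ← ep]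
  congr 1
  ring

theorem Sq_self_shift (X : R) (c k : ℤ) (r : ℕ) : Sq X (c + k) r r = Sq X c r r := by
  simp [Sq, Cq]

theorem Sq_self_succ (X : R) (c : ℤ) (r : ℕ) :
    Sq X c (r + 1) (r + 1) = (1 + q ^ (r + 1)) • Sq X c r r := by
  have h := Sq_succ_right X c 0 r
  simp only [zero_add] at h
  rw [h, Sq_self_shift, add_smul, one_smul]

theorem Sq_shift (X : R) (c : ℤ) (m r : ℕ) :
    Sq X (c + 1) (m + 1 + r) r
      = q ^ (m + 1) • Sq X c (m + 1 + r) r + Sq X c (m + r) r := by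
  simp only [Sq, Nat.add_sub_cancel]
  rw [Finset.smul_sum, ← Finset.sum_add_distrib]
  refine Finset.sum_congr rfl fun s _ => ?_
  rw [add_right_comm, Cq_succ_shift, smul_add, smul_comm]

theorem Sq_succ_left (X : R) (c : ℤ) (m r : ℕ) :
    (q ^ (m + r + 1) - 1) • Sq X c (m + 1 + r) r
      = q ^ r • ((q ^ (c + r - m) • X - 1) * Sq X c (m + r) r)
        + (q ^ (2 * r) - 1) • Sq X c (m + r) (r - 1) := by
  induction r generalizing c with
  | zero => simp [Sq_zero_right, Cq_succ]
  | succ r ih =>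
    have h := ih c
    have h' := ih (c + 1)
    have hs := Sq_shift X c m r
    have hP : (q ^ (2 * r) - 1) • Sq X c (m + 1 + r) r = (q ^ (2 * r) - 1) •
        (Sq X c (m + r) (r - 1) + q ^ r • Sq X (c + 1) (m + r) (r - 1)) := by
      rcases r with _ | r
      · simp
      · rw [Sq_succ_right]
        simp only [Nat.add_sub_cancel, ← add_assoc, add_right_comm m 1 r]
    have e1 : q ^ (c + 1 + r - m) = q * q ^ (c + r - m) := by
      rw [← zpow_one_add₀ q_ne_zero]; congr 1; ring
    have e2 : q ^ (c + ((r + 1 : ℕ) : ℤ) - m) = q * q ^ (c + r - m) := by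
      rw [← zpow_one_add₀ q_ne_zero]; congr 1; push_cast; ring
    have e3 : m + (r + 1) = m + 1 + r := by omega
    rw [Sq_succ_right, Sq_succ_right, e2, Nat.add_sub_cancel, e3]
    rw [e1] at h'
    simp only [sub_mul, mul_add, smul_mul_assoc, one_mul, mul_smul_comm] at h h' ⊢
    exact bracket_recursion_step h h' hs hP

end Brackets

/-- The coefficient of `(y * z) ^ r` in the expansion of `C_q(x + (q - q⁻¹)² y z; t, n)`. -/
noncomputable def expansionCoeff (t : ℤ) (n r : ℕ) : K :=
  q ^ ((r : ℤ) * (t - (n : ℤ))) * (q - q⁻¹) ^ r * (qintFact r)⁻¹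

theorem expansionCoeff_succ_left (t : ℤ) (n r : ℕ) :
    expansionCoeff t n r = q ^ r * expansionCoeff t (n + 1) r := by
  have e : (r : ℤ) * (t - n) = r + r * (t - ((n + 1 : ℕ) : ℤ)) := by push_cast; ring
  rw [expansionCoeff, expansionCoeff, e, zpow_add₀ q_ne_zero, zpow_natCast]
  ring

theorem expansionCoeff_succ_right (t : ℤ) (n r : ℕ) :
    expansionCoeff t (n + 1) (r + 1) * (q ^ (2 * (r + 1)) - 1)
      = q ^ (t - n) * (q - q⁻¹) ^ 2 * expansionCoeff t n r := by
  have e : ((r + 1 : ℕ) : ℤ) * (t - ((n + 1 : ℕ) : ℤ)) + ((r + 1 : ℕ) : ℤ)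
      = (t - n) + r * (t - n) := by push_cast; ring
  have hz : q ^ (((r + 1 : ℕ) : ℤ) * (t - ((n + 1 : ℕ) : ℤ))) * q ^ (r + 1)
      = q ^ (t - n) * q ^ (r * (t - (n : ℤ))) := by
    rw [← zpow_natCast q (r + 1), ← zpow_add₀ q_ne_zero, e, zpow_add₀ q_ne_zero]
  have h1 := qint_ne_zero r.succ_ne_zero
  rw [expansionCoeff, expansionCoeff, ← qint_mul, qintFact_succ, mul_inv]
  simp only [Nat.succ_eq_add_one] at h1
  generalize q ^ (((r + 1 : ℕ) : ℤ) * (t - ((n + 1 : ℕ) : ℤ))) = a at *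
  generalize q ^ (t - (n : ℤ)) = b at *
  generalize q ^ (r * (t - (n : ℤ))) = d at *
  have h3 : (qint (r + 1))⁻¹ * qint (r + 1) = 1 := inv_mul_cancel₀ h1
  linear_combination (q - q⁻¹) ^ (r + 2) * (qintFact r)⁻¹ * hz +
    (q - q⁻¹) ^ (r + 2) * (qintFact r)⁻¹ * (a * q ^ (r + 1)) * h3

theorem Cq_add_smul {R : Type*} [Ring R] [Algebra K R] (x w : R)
    (hxw : x * w = q ^ 2 • (w * x)) (t : ℤ) (n : ℕ) :
    Cq (x + (q - q⁻¹) ^ 2 • w) t n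
      = ∑ r ∈ range (n + 1), expansionCoeff t n r • (w ^ r * Sq x t n r) := by
  induction n with
  | zero => simp [expansionCoeff, Sq_zero_right, Cq, qintFact_zero]
  | succ n ih =>
    have hpow : ∀ r : ℕ, x * w ^ r = q ^ (2 * r) • (w ^ r * x) := by
      intro r
      induction r with
      | zero => simp
      | succ r ih =>
        rw [pow_succ, ← mul_assoc, ih, smul_mul_assoc, mul_assoc, hxw, mul_smul_comm, smul_smul,
          ← mul_assoc, ← pow_add, mul_add_one]
    set g : ℕ → R := fun r =>
      (expansionCoeff t (n + 1) r * (q ^ (2 * r) - 1)) • (w ^ r * Sq x t n (r - 1)) with hg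
    have hterm : ∀ r ∈ range (n + 1),
        (q ^ (t - (n : ℤ)) • (x + (q - q⁻¹) ^ 2 • w) - 1)
            * (expansionCoeff t n r • (w ^ r * Sq x t n r))
          = (q ^ (n + 1) - 1) • (expansionCoeff t (n + 1) r • (w ^ r * Sq x t (n + 1) r))
            + (g (r + 1) - g r) := by
      intro r hr
      obtain ⟨m, rfl⟩ := Nat.exists_eq_add_of_le' (show r ≤ n by simp at hr; omega)
      have hS := congrArg (w ^ r * ·) (Sq_succ_left x t m r)
      have ez : q ^ (t - ((m + r : ℕ) : ℤ)) * q ^ (2 * r) = q ^ (t + r - m) := by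
        rw [← zpow_natCast, ← zpow_add₀ q_ne_zero]; congr 1; push_cast; ring
      have hx : x * (w ^ r * Sq x t (m + r) r)
          = q ^ (2 * r) • (w ^ r * (x * Sq x t (m + r) r)) := by
        rw [← mul_assoc, hpow, smul_mul_assoc, mul_assoc]
      have hw : w * (w ^ r * Sq x t (m + r) r) = w ^ (r + 1) * Sq x t (m + r) r := by
        rw [pow_succ', mul_assoc]
      simp only [hg, expansionCoeff_succ_right, Nat.add_sub_cancel]
      rw [show m + r + 1 = m + 1 + r by omega] at *
      have ed : expansionCoeff t (m + r) r = q ^ r * expansionCoeff t (m + 1 + r) r := by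
        rw [expansionCoeff_succ_left, show m + r + 1 = m + 1 + r by omega]
      simp only [sub_mul, add_mul, mul_add, mul_sub, smul_mul_assoc, one_mul, mul_smul_comm,
        mul_one, hx, hw, smul_add] at hS ⊢
      rw [← ez] at hS
      rw [ed]
      exact expansion_step hS
    apply smul_right_injective R (q_pow_sub_one_ne_zero n.succ_ne_zero)
    simp only [Nat.succ_eq_add_one]
    have hlast : g (n + 1) = (q ^ (n + 1) - 1) •
        (expansionCoeff t (n + 1) (n + 1) • (w ^ (n + 1) * Sq x t (n + 1) (n + 1))) := by
      simp only [hg, Nat.add_sub_cancel]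
      rw [Sq_self_succ, mul_smul_comm, smul_smul, smul_smul]
      congr 1
      ring
    have hzero : g 0 = 0 := by simp [hg]
    rw [Cq_succ, ih, Finset.mul_sum, Finset.sum_congr rfl hterm, Finset.sum_add_distrib,
      Finset.sum_range_sub, hzero, sub_zero, hlast, ← Finset.smul_sum, ← smul_add,
      ← Finset.sum_range_succ
        (fun r => expansionCoeff t (n + 1) r • (w ^ r * Sq x t (n + 1) r))]

theorem pow_mul_Sq_mul_pow {R : Type*} [Ring R] [Algebra K R] {x y z : R}
    (hxz : x * z = q • (z * x)) (hyz : Commute y z) (t : ℤ) (n r : ℕ) :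
    y ^ r * Sq x (t - r) n r * z ^ r = (y * z) ^ r * Sq x t n r := by
  have hpow : ∀ k : ℕ, x * z ^ k = q ^ k • (z ^ k * x) := by
    intro k
    induction k with
    | zero => simp
    | succ k ih =>
      rw [pow_succ, ← mul_assoc, ih, smul_mul_assoc, mul_assoc, hxz, mul_smul_comm, smul_smul,
        ← mul_assoc, ← pow_succ]
  have h : SemiconjBy (z ^ r) (q ^ (r : ℤ) • x) x := by
    rw [SemiconjBy, hpow, mul_smul_comm, zpow_natCast]
  have hS := (Sq_semiconj h (t - r) n r).eq
  rw [Sq_zpow_smul, sub_add_cancel] at hS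
  rw [mul_assoc, ← hS, ← mul_assoc, hyz.mul_pow]

theorem statement4 {A : Type*} [Ring A] [Algebra K A] (x y z : A)
    (hxy : x * y = (q : K) • (y * x)) (hxz : x * z = (q : K) • (z * x))
    (hyz : y * z = z * y) (n : ℕ) (t : ℤ) :
    Cq (x + ((q - q⁻¹) ^ 2 : K) • (y * z)) t n =
      ∑ r ∈ Finset.range (n + 1),
        (q ^ ((r : ℤ) * (t - (n : ℤ))) * (q - q⁻¹) ^ r * qintFact r) •
          (dp y r * Sq x (t - (r : ℤ)) n r * dp z r) := by
  have hxw : x * (y * z) = q ^ 2 • (y * z * x) := by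
    rw [← mul_assoc, hxy, smul_mul_assoc, mul_assoc, hxz, mul_smul_comm, smul_smul, ← mul_assoc,
      pow_two]
  rw [Cq_add_smul x (y * z) hxw t n]
  refine Finset.sum_congr rfl fun r _ => ?_
  have h := qintFact_ne_zero r
  rw [dp, dp, smul_mul_assoc, smul_mul_assoc, mul_smul_comm, pow_mul_Sq_mul_pow hxz hyz, smul_smul,
    smul_smul, expansionCoeff]
  congr 1
  field_simp
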